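/- Let ⟨{a,b}, C, d, O, v, (≺_a, ≺_b)⟩ be a two-player antagonistic infinite sequential game with C finite, i.e. ≺_b = ≺^{-1} where ≺ := ≺_a, and let Γ be a collection of subsets of C^ω. Assume: (1) ≺ is a strict weak order; (2) for each X ∈ {a,b}, for every play p ∈ C^ω, every sequence (s_n)_{n∈ℕ} of strategies of X, and every strictly increasing φ : ℕ → ℕ, if d(p_{<φ(n)}) = X and g_X(p_{<φ(n+1)}, s_{n+1}) ⊊ g_X(p_{<φ(n)}, s_n) for all n ∈ ℕ, then v(p) ∈ ∩_{n∈ℕ} g_X(p_{<φ(n)}, s_n); (3) for every ≺-extremal interval I and every γ ∈ C*, v^{-1}(I) ∩ γC^ω ∈ Γ; (4) every two-player win/lose game ⟨C, D, W⟩ with D ⊆ C* and W ∈ Γ is determined. Then the game has a subgame perfect equilibrium. -/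

import Mathlib

namespace SeqGame

variable {A C O : Type*}

/-- The length-`n` prefix of an infinite sequence, as a list. -/
def pre (p : ℕ → C) (n : ℕ) : List C := List.ofFn (fun i : Fin n => p i)

/-- The length-`n` history of the play induced by the strategy profile `σ` starting at `γ`. -/
def hist (σ : List C → C) (γ : List C) : ℕ → List C
  | 0 => []
  | n + 1 => hist σ γ n ++
      [if h : n < γ.length then γ.get ⟨n, h⟩ else σ (hist σ γ n)]

/-- The play `p^γ(σ)` induced by the strategy profile `σ` starting at `γ`. -/
def play (σ : List C → C) (γ : List C) (n : ℕ) : C :=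
  if h : n < γ.length then γ.get ⟨n, h⟩ else σ (hist σ γ n)

/-- `σ'` is an `a`-deviation of the strategy profile `σ`. -/
def Dev (d : List C → A) (a : A) (σ σ' : List C → C) : Prop :=
  ∀ h : List C, d h ≠ a → σ' h = σ h

/-- `r` is a strict weak order: irreflexive, transitive, with transitive incomparability. -/
def SWO (r : O → O → Prop) : Prop :=
  (∀ x, ¬ r x x) ∧ (∀ x y z, r x y → r y z → r x z) ∧
  (∀ x y z, ¬ r x y → ¬ r y z → ¬ r x z)

/-- `r` is a strict linear order: irreflexive, transitive and total. -/
def SLO (r : O → O → Prop) : Prop :=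
  (∀ x, ¬ r x x) ∧ (∀ x y z, r x y → r y z → r x z) ∧
  (∀ x y, x = y ∨ r x y ∨ r y x)

/-- The play `p` is consistent with the strategy `s` of player `a` from `γ` on. -/
def Consistent (d : List C → A) (a : A) (s : List C → C) (γ : List C) (p : ℕ → C) : Prop :=
  pre p γ.length = γ ∧ ∀ n, γ.length ≤ n → d (pre p n) = a → p n = s (pre p n)

/-- The guarantee `g_a(γ, s)` of player `a` (with preference `r`) by strategy `s` at `γ`. -/
def gua (d : List C → A) (v : (ℕ → C) → O) (r : O → O → Prop) (a : A)
    (γ : List C) (s : List C → C) : Set O :=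
  {o | ∃ p : ℕ → C, Consistent d a s γ p ∧ ¬ r o (v p)}

/-- The best guarantee `G_a(γ)` of player `a` (with preference `r`) at `γ`. -/
def Gua (d : List C → A) (v : (ℕ → C) → O) (r : O → O → Prop) (a : A) (γ : List C) : Set O :=
  ⋂ s : List C → C, gua d v r a γ s

/-- `I` is a `r`-terminal interval: `o ∈ I` and `¬(o' ≺ o)` imply `o' ∈ I`. -/
def Terminal (r : O → O → Prop) (I : Set O) : Prop :=
  ∀ o ∈ I, ∀ o', ¬ r o' o → o' ∈ I

/-- `I` is a `r`-extremal interval. -/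
def Extremal (r : O → O → Prop) (I : Set O) : Prop :=
  Terminal r I ∨ Terminal (fun x y => r y x) I

/-- `γ C^ω`: the set of plays extending the finite sequence `γ`. -/
def ext (γ : List C) : Set (ℕ → C) := {p | pre p γ.length = γ}

/-- Concatenation `γ·α` of a finite sequence and an infinite one. -/
def cat (γ : List C) (α : ℕ → C) : ℕ → C :=
  fun n => if h : n < γ.length then γ.get ⟨n, h⟩ else α (n - γ.length)

/-- The two-player win/lose game `⟨C, D, W⟩` is determined. -/
def Determined (D : Set (List C)) (W : Set (ℕ → C)) : Prop :=
  (∃ s : List C → C, ∀ p : ℕ → C, (∀ n, pre p n ∈ D → p n = s (pre p n)) → p ∈ W) ∨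
  (∃ t : List C → C, ∀ p : ℕ → C, (∀ n, pre p n ∉ D → p n = t (pre p n)) → p ∉ W)

/-- In a two-player game (`true` is player `a`, `false` is player `b`) with antagonistic
preferences, the preference of each player derived from the preference `r` of player `a`. -/
def rel (r : O → O → Prop) : Bool → O → O → Prop
  | true => r
  | false => fun o o' => r o' o

end SeqGame

namespace SeqGame

variable {A C O : Type*}

theorem length_pre (p : ℕ → C) (n : ℕ) : (pre p n).length = n := by simp [pre]

theorem pre_succ (p : ℕ → C) (n : ℕ) : pre p (n + 1) = pre p n ++ [p n] := by
  simp only [pre, List.ofFn_succ_last]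
  rfl

theorem pre_prefix (p : ℕ → C) {m n : ℕ} (hmn : m ≤ n) : pre p m <+: pre p n := by
  induction n, hmn using Nat.le_induction with
  | base => exact List.prefix_rfl
  | succ n _ ih => exact ih.trans (pre_succ p n ▸ List.prefix_append _ _)

theorem SWO.rel {r : O → O → Prop} (hr : SWO r) (X : Bool) : SWO (rel r X) := by
  cases X
  · exact ⟨hr.1, fun x y z h h' => hr.2.1 z y x h' h, fun x y z h h' => hr.2.2 z y x h' h⟩
  · exact hr

theorem Terminal.total {r : O → O → Prop} (hr : SWO r) {I J : Set O}
    (hI : Terminal r I) (hJ : Terminal r J) : I ⊆ J ∨ J ⊆ I := by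
  by_contra! h
  obtain ⟨hIJ, hJI⟩ := h
  obtain ⟨x, hxI, hxJ⟩ := Set.not_subset.1 hIJ
  obtain ⟨y, hyJ, hyI⟩ := Set.not_subset.1 hJI
  have hyx : r y x := by_contra fun h => hyI (hI x hxI y h)
  have hxy : r x y := by_contra fun h => hxJ (hJ y hyJ x h)
  exact hr.1 _ (hr.2.1 _ _ _ hxy hyx)

theorem play_consistent {d : List C → A} {a : A} {σ s : List C → C} (γ : List C)
    (h : ∀ x, d x = a → σ x = s x) : Consistent d a s γ (play σ γ) := by
  have hpre : ∀ n, pre (play σ γ) n = hist σ γ n := by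
    intro n
    induction n with
    | zero => simp [pre, hist]
    | succ n ih => rw [pre_succ, ih]; rfl
  refine ⟨?_, fun n hn hd => ?_⟩
  · apply List.ext_getElem
    · simp [pre]
    · intro i _ hi
      simp [pre, play]
  · rw [← h _ hd, hpre]
    simp [play, hn.not_gt]

/-- A choice of strategies, one for each history, that satisfies `P` wherever possible and is
changed along a history only when `P` would fail otherwise. -/
theorem exists_persistent_choice {S : Type*} [Nonempty S] (P : List C → S → Prop) :
    ∃ t : List C → S, (∀ h, (∃ s, P h s) → P h (t h)) ∧
      ∀ h c, P (h ++ [c]) (t h) → t (h ++ [c]) = t h := by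
  classical
  let f : List C → S := fun h => Classical.epsilon (P h)
  let t : List C → S := fun h => List.reverseRecOn h (f [])
    fun l c s => if P (l ++ [c]) s then s else f (l ++ [c])
  have ht : ∀ h c, t (h ++ [c]) = if P (h ++ [c]) (t h) then t h else f (h ++ [c]) := by
    intro h c
    simp [t]
  refine ⟨t, fun h => ?_, fun h c hP => by rw [ht, if_pos hP]⟩
  induction h using List.reverseRecOn with
  | nil =>
    intro hs
    simpa [t] using Classical.epsilon_spec hs
  | append_singleton h c _ =>
    intro hs
    rw [ht]
    split_ifs with hP
    · exact hP
    · exact Classical.epsilon_spec hs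

section Guarantee

variable {d : List C → A} {v : (ℕ → C) → O} {r : O → O → Prop} {a : A}

theorem mem_gua (hr : SWO r) {γ : List C} {s : List C → C} {p : ℕ → C}
    (hp : Consistent d a s γ p) : v p ∈ gua d v r a γ s :=
  ⟨p, hp, hr.1 _⟩

theorem terminal_gua (hr : SWO r) (γ : List C) (s : List C → C) :
    Terminal r (gua d v r a γ s) := by
  rintro o ⟨p, hp, hop⟩ o' ho'
  exact ⟨p, hp, hr.2.2 _ _ _ ho' hop⟩

theorem terminal_Gua (hr : SWO r) (γ : List C) : Terminal r (Gua d v r a γ) := by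
  intro o ho o' ho'
  simp only [Gua, Set.mem_iInter] at ho ⊢
  exact fun s => terminal_gua hr γ s o (ho s) o' ho'

theorem Gua_subset (γ : List C) (s : List C → C) : Gua d v r a γ ⊆ gua d v r a γ s :=
  Set.iInter_subset _ s

theorem gua_concat_subset {h : List C} {c : C} {s : List C → C} (hc : d h = a → c = s h) :
    gua d v r a (h ++ [c]) s ⊆ gua d v r a h s := by
  rintro o ⟨p, ⟨hpre, hp⟩, ho⟩
  rw [List.length_append, List.length_singleton, pre_succ] at hpre
  obtain ⟨hh, hcp⟩ := List.append_inj' hpre rfl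
  refine ⟨p, ⟨hh, fun n hn hd => ?_⟩, ho⟩
  rcases hn.eq_or_lt with rfl | hn
  · rw [hh] at hd ⊢
    rw [← hc hd]
    simpa using hcp
  · exact hp n (by simpa using hn) hd

theorem gua_pre_succ_subset {p : ℕ → C} {n : ℕ} {s : List C → C}
    (h : d (pre p n) = a → p n = s (pre p n)) :
    gua d v r a (pre p (n + 1)) s ⊆ gua d v r a (pre p n) s := by
  rw [pre_succ]
  exact gua_concat_subset h

theorem Gua_concat_subset {h : List C} (hd : d h ≠ a) (c : C) :
    Gua d v r a (h ++ [c]) ⊆ Gua d v r a h :=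
  Set.iInter_mono fun _ => gua_concat_subset fun h' => absurd h' hd

theorem consistent_pre {s : List C → C} {p : ℕ → C} {N : ℕ}
    (h : ∀ n, N ≤ n → d (pre p n) = a → p n = s (pre p n)) :
    Consistent d a s (pre p N) p := by
  refine ⟨by rw [length_pre], fun n hn => h n ?_⟩
  rwa [length_pre] at hn

theorem mem_Gua_of_forall_ne (hr : SWO r) {p : ℕ → C} {N : ℕ}
    (h : ∀ n, N ≤ n → d (pre p n) ≠ a) : v p ∈ Gua d v r a (pre p N) :=
  Set.mem_iInter.2 fun _ => mem_gua hr (consistent_pre fun n hn hd => absurd hd (h n hn))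

/-- With finitely many choices, a player can preserve an upper bound on her best guarantee. -/
theorem exists_Gua_concat_subset [Nonempty C] [Finite C] (hr : SWO r) {h : List C} {T : Set O}
    (hT : Gua d v r a h ⊆ T) : ∃ c, Gua d v r a (h ++ [c]) ⊆ T := by
  obtain ⟨c₀, -, hc₀⟩ := 
    Set.finite_univ.exists_minimalFor (fun c => Gua d v r a (h ++ [c])) Set.univ Set.univ_nonempty
  refine ⟨c₀, fun o ho => hT (Set.mem_iInter.2 fun s => ?_)⟩
  have hle : Gua d v r a (h ++ [c₀]) ⊆ Gua d v r a (h ++ [s h]) :=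
    (Terminal.total hr (terminal_Gua hr _) (terminal_Gua hr _)).elim id fun h' => hc₀ trivial h'
  exact gua_concat_subset (fun _ => rfl) (Gua_subset _ s (hle ho))

/-- A play meets every guarantee that starts a strictly decreasing sequence of guarantees of the
player along the play. -/
def DescentClosed (d : List C → A) (v : (ℕ → C) → O) (r : O → O → Prop) (a : A) : Prop :=
  ∀ (p : ℕ → C) (s : ℕ → List C → C) (φ : ℕ → ℕ), StrictMono φ →
    (∀ n, d (pre p (φ n)) = a) →
    (∀ n, gua d v r a (pre p (φ (n + 1))) (s (n + 1)) ⊂ gua d v r a (pre p (φ n)) (s n)) →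
    v p ∈ ⋂ n, gua d v r a (pre p (φ n)) (s n)

theorem DescentClosed.mem_gua (hdc : DescentClosed d v r a) {p : ℕ → C}
    (Q : ℕ → (List C → C) → Prop) (hQ : ∀ n s, Q n s → d (pre p n) = a)
    (hstep : ∀ n s, Q n s → ∃ n' s', n < n' ∧ Q n' s' ∧
      gua d v r a (pre p n') s' ⊂ gua d v r a (pre p n) s)
    {n₀ : ℕ} {s₀ : List C → C} (h₀ : Q n₀ s₀) : v p ∈ gua d v r a (pre p n₀) s₀ := by
  choose! fn fs hlt hQ' hss using hstep
  let x : ℕ → ℕ × (List C → C) := fun k => (fun y => (fn y.1 y.2, fs y.1 y.2))^[k] (n₀, s₀)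
  have hx : ∀ k, x (k + 1) = (fn (x k).1 (x k).2, fs (x k).1 (x k).2) := fun k =>
    Function.iterate_succ_apply' _ _ _
  have hQx : ∀ k, Q (x k).1 (x k).2 := by
    intro k
    induction k with
    | zero => exact h₀
    | succ k ih => rw [hx]; exact hQ' _ _ ih
  have := hdc p (fun k => (x k).2) (fun k => (x k).1)
    (strictMono_nat_of_lt_succ fun k => by rw [hx]; exact hlt _ _ (hQx k))
    (fun k => hQ _ _ (hQx k))
    (fun k => by rw [hx]; exact hss _ _ (hQx k))
  exact Set.mem_iInter.1 this 0

/-- The best guarantee at a history is achieved by some strategy. -/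
theorem exists_gua_subset_Gua [Nonempty C] [Finite C] (hr : SWO r)
    (hdc : DescentClosed d v r a) (γ : List C) :
    ∃ s, gua d v r a γ s ⊆ Gua d v r a γ := by
  set T := Gua d v r a γ with hT
  obtain ⟨t, htP, htc⟩ := exists_persistent_choice fun h s => gua d v r a h s ⊆ T
  obtain ⟨σ, hσ⟩ : ∃ σ : List C → C, ∀ h,
      ((∃ s, gua d v r a h s ⊆ T) → σ h = t h h) ∧
      ((¬ ∃ s, gua d v r a h s ⊆ T) → Gua d v r a h ⊆ T → Gua d v r a (h ++ [σ h]) ⊆ T) := by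
    rw [← Classical.skolem (p := fun h c => ((∃ s, gua d v r a h s ⊆ T) → c = t h h) ∧
      ((¬ ∃ s, gua d v r a h s ⊆ T) → Gua d v r a h ⊆ T → Gua d v r a (h ++ [c]) ⊆ T))]
    intro h
    by_cases hg : ∃ s, gua d v r a h s ⊆ T
    · exact ⟨t h h, fun _ => rfl, fun h' => absurd hg h'⟩
    · by_cases hs : Gua d v r a h ⊆ T
      · obtain ⟨c, hc⟩ := exists_Gua_concat_subset hr hs
        exact ⟨c, fun h' => absurd h' hg, fun _ _ => hc⟩
      · exact ⟨t h h, fun _ => rfl, fun _ h' => absurd h' hs⟩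
  refine ⟨σ, ?_⟩
  rintro o ⟨p, ⟨hpγ, hp⟩, hop⟩
  refine terminal_Gua hr γ (v p) ?_ o hop
  rw [← hT]
  by_cases hN : ∃ N, γ.length ≤ N ∧ ∃ s, gua d v r a (pre p N) s ⊆ T
  · obtain ⟨N, hNγ, hgood⟩ := hN
    have key : ∀ n, N ≤ n → t (pre p n) = t (pre p N) ∧
        gua d v r a (pre p n) (t (pre p N)) ⊆ T := by
      intro n hn
      induction n, hn using Nat.le_induction with
      | base => exact ⟨rfl, htP _ hgood⟩
      | succ n hn ih =>
        have hsub : gua d v r a (pre p (n + 1)) (t (pre p N)) ⊆ T :=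
          (gua_pre_succ_subset fun hd => by
            rw [hp n (hNγ.trans hn) hd, (hσ _).1 ⟨_, ih.2⟩, ih.1]).trans ih.2
        refine ⟨?_, hsub⟩
        rw [pre_succ, ← ih.1] at hsub
        rw [pre_succ, htc _ _ hsub, ih.1]
    refine (key N le_rfl).2 (mem_gua hr (consistent_pre fun n hn hd => ?_))
    rw [hp n (hNγ.trans hn) hd, (hσ _).1 ⟨_, (key n hn).2⟩, (key n hn).1]
  · have hbad : ∀ n, γ.length ≤ n → ¬ ∃ s, gua d v r a (pre p n) s ⊆ T :=
      fun n hn h => hN ⟨n, hn, h⟩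
    have hsub : ∀ n, γ.length ≤ n → Gua d v r a (pre p n) ⊆ T := by
      intro n hn
      induction n, hn using Nat.le_induction with
      | base => rw [hpγ]
      | succ n hn ih =>
        rw [pre_succ]
        by_cases hd : d (pre p n) = a
        · rw [hp n hn hd]
          exact (hσ _).2 (hbad n hn) ih
        · exact (Gua_concat_subset hd _).trans ih
    by_cases hfin : ∃ N, ∀ n, N ≤ n → d (pre p n) ≠ a
    · obtain ⟨N, hN⟩ := hfin
      exact hsub (max N γ.length) (le_max_right _ _)
        (mem_Gua_of_forall_ne hr fun n hn => hN n ((le_max_left _ _).trans hn))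
    · push Not at hfin
      by_contra hv
      obtain ⟨n₀, hn₀, hd₀⟩ := hfin γ.length
      obtain ⟨s₀, hs₀⟩ : ∃ s, v p ∉ gua d v r a (pre p n₀) s := by
        simpa [Gua] using fun h => hv (hsub n₀ hn₀ h)
      refine hs₀ (hdc.mem_gua (fun n _ => γ.length ≤ n ∧ d (pre p n) = a)
        (fun _ _ h => h.2) ?_ ⟨hn₀, hd₀⟩)
      rintro n s ⟨hn, -⟩
      obtain ⟨o', ho', ho'T⟩ := Set.not_subset.1 fun h => hbad n hn ⟨s, h⟩
      obtain ⟨n', hn', hd'⟩ := hfin (n + 1)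
      have hγn' : γ.length ≤ n' := by omega
      obtain ⟨s', hs'⟩ : ∃ s, o' ∉ gua d v r a (pre p n') s := by
        simpa [Gua] using fun h => ho'T (hsub n' hγn' h)
      refine ⟨n', s', hn', ⟨hγn', hd'⟩, ?_, fun h => hs' (h ho')⟩
      exact (Terminal.total hr (terminal_gua hr _ _) (terminal_gua hr _ _)).resolve_right
        fun h => hs' (h ho')

/-- A single strategy achieves the best guarantee at all histories. -/
theorem exists_forall_gua_subset_Gua [Nonempty C] [Finite C] (hr : SWO r)
    (hdc : DescentClosed d v r a) :
    ∃ s, ∀ γ, gua d v r a γ s ⊆ Gua d v r a γ := by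
  obtain ⟨t, htP, htc⟩ := exists_persistent_choice fun h s => gua d v r a h s ⊆ Gua d v r a h
  replace htP := fun h => htP h (exists_gua_subset_Gua hr hdc h)
  refine ⟨fun h => t h h, fun γ => ?_⟩
  rintro o ⟨p, ⟨hpγ, hp⟩, hop⟩
  refine terminal_Gua hr γ (v p) ?_ o hop
  have hstep : ∀ n, γ.length ≤ n →
      gua d v r a (pre p (n + 1)) (t (pre p n)) ⊆ Gua d v r a (pre p n) := fun n hn =>
    (gua_pre_succ_subset (hp n hn)).trans (htP _)
  have hanti : ∀ m, γ.length ≤ m → ∀ n, m ≤ n →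
      Gua d v r a (pre p n) ⊆ Gua d v r a (pre p m) := by
    intro m hm n hn
    induction n, hn using Nat.le_induction with
    | base => exact subset_rfl
    | succ n hn ih => exact ((Gua_subset _ _).trans (hstep n (hm.trans hn))).trans ih
  have hsub : ∀ n, γ.length ≤ n → Gua d v r a (pre p n) ⊆ Gua d v r a γ := by
    intro n hn
    have := hanti _ le_rfl n hn
    rwa [hpγ] at this
  by_cases hfin : ∃ N, ∀ n, N ≤ n → d (pre p n) ≠ a
  · obtain ⟨N, hN⟩ := hfin
    exact hsub (max N γ.length) (le_max_right _ _)
      (mem_Gua_of_forall_ne hr fun n hn => hN n ((le_max_left _ _).trans hn))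
  push Not at hfin
  by_cases hconst : ∃ M, γ.length ≤ M ∧ ∀ n, M ≤ n →
      Gua d v r a (pre p M) ⊆ Gua d v r a (pre p n)
  · obtain ⟨M, hM, hMn⟩ := hconst
    have ht : ∀ n, M ≤ n → t (pre p n) = t (pre p M) := by
      intro n hn
      induction n, hn using Nat.le_induction with
      | base => rfl
      | succ n hn ih =>
        have h := ((hstep n (hM.trans hn)).trans (hanti M hM n hn)).trans (hMn (n + 1) (by omega))
        rw [pre_succ] at h ⊢
        rw [htc _ _ h, ih]
    refine hsub M hM (htP _ (mem_gua hr (consistent_pre fun n hn hd => ?_)))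
    rw [← ht n hn]
    exact hp n (hM.trans hn) hd
  · push Not at hconst
    obtain ⟨n₀, hn₀, hd₀⟩ := hfin γ.length
    refine hsub n₀ hn₀ (htP _ (hdc.mem_gua
      (fun n s => γ.length ≤ n ∧ d (pre p n) = a ∧ s = t (pre p n))
      (fun _ _ h => h.2.1) ?_ ⟨hn₀, hd₀, rfl⟩))
    rintro n _ ⟨hn, -, rfl⟩
    obtain ⟨m, hm, hlt⟩ := hconst n hn
    obtain ⟨n', hn', hd'⟩ := hfin (m + 1)
    have hle : gua d v r a (pre p n') (t (pre p n')) ⊆ Gua d v r a (pre p m) :=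
      (htP _).trans (hanti m (hn.trans hm) n' (by omega))
    exact ⟨n', _, by omega, ⟨by omega, hd', rfl⟩,
      hle.trans ((hanti n hn m hm).trans (Gua_subset _ _)),
      fun h => hlt (((Gua_subset _ _).trans h).trans hle)⟩

end Guarantee

theorem extremal_setOf_rel {r : O → O → Prop} (hr : SWO r) (X : Bool) (o : O) :
    Extremal r {o' | rel r X o o'} := by
  have h : Terminal (rel r X) {o' | rel r X o o'} := fun x hx y hy =>
    by_contra fun hoy => (hr.rel X).2.2 _ _ _ hoy hy hx
  cases X
  · exact Or.inr h
  · exact Or.inl h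

/-- Determinacy prevents an outcome in the best guarantee of a player from being worse for her
than an outcome in the best guarantee of the opponent. -/
theorem not_rel_of_mem_Gua {r : O → O → Prop} (hr : SWO r)
    {d : List C → Bool} {v : (ℕ → C) → O} {γ : List C} {X : Bool} {o o' : O}
    (hdet : ∀ D, Determined D (v ⁻¹' {x | rel r X o x} ∩ ext γ))
    (ho : o ∈ Gua d v (rel r X) X γ) (ho' : o' ∈ Gua d v (rel r (!X)) (!X) γ) :
    ¬ rel r X o o' := by
  intro hlt
  have hflip : ∀ x y, rel r (!X) x y ↔ rel r X y x := by cases X <;> simp [rel]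
  rcases hdet {h | (h.length < γ.length ∧ h <+: γ) ∨ d h = X} with ⟨s, hs⟩ | ⟨t, ht⟩
  · have hγ : ∀ n, n < γ.length → ∀ p, pre p γ.length = γ → p n = s (pre p n) := by
      have hq := play_consistent (d := fun _ => ()) (a := ()) (σ := s) (s := s) []
        fun _ _ => rfl
      have hqs := hq.2
      simp only [List.length_nil, Nat.zero_le, forall_const] at hqs
      have hqγ : pre (play s []) γ.length = γ := (hs _ fun n _ => hqs n).2
      intro n hn p hp
      have hpq : ∀ m, m ≤ γ.length → pre p m = pre (play s []) m := fun m hm =>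
        ((List.prefix_of_prefix_length_le (pre_prefix p hm)
          (hp.trans hqγ.symm ▸ pre_prefix (play s []) hm) (by simp [length_pre])).eq_of_length
          (by simp [length_pre]))
      have h1 := hpq (n + 1) hn
      rw [pre_succ, pre_succ] at h1
      have h2 := List.append_inj' h1 rfl
      rw [h2.1, ← hqs n]
      simpa using h2.2
    obtain ⟨p, ⟨hpγ, hp⟩, hop⟩ := Gua_subset _ s ho
    refine hop (hs p fun n hn => ?_).1
    rcases lt_or_ge n γ.length with h | h
    · exact hγ n h p hpγ
    · rcases hn with hn | hn
      · rw [length_pre] at hn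
        omega
      · exact hp n h hn
  · obtain ⟨p, ⟨hpγ, hp⟩, hop⟩ := Gua_subset _ t ho'
    refine ht p (fun n hn => ?_) ⟨?_, hpγ⟩
    · simp only [Set.mem_ofPred_eq, not_or, not_and, length_pre] at hn
      refine hp n (le_of_not_gt fun h => hn.1 h ?_) (Bool.eq_not.2 hn.2)
      exact hpγ ▸ (pre_prefix p h.le)
    · rw [hflip] at hop
      by_contra h
      exact (hr.rel X).2.2 _ _ _ h hop hlt

end SeqGame


open SeqGame in
/-- existence of subgame perfect equilibria in two-player antagonistic
infinite sequential games with finitely many choices (player `a` is `true`, player `b`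
is `false`, with preferences `r` and its inverse). -/
theorem stmt9 {C O : Type*} [Nonempty C] [Finite C] [Nonempty O]
    (d : List C → Bool) (v : (ℕ → C) → O) (r : O → O → Prop)
    (Γ : Set (Set (ℕ → C)))
    (h1 : SWO r)
    (h2 : ∀ (X : Bool) (p : ℕ → C) (s : ℕ → List C → C) (φ : ℕ → ℕ), StrictMono φ →
      (∀ n, d (pre p (φ n)) = X) →
      (∀ n, gua d v (rel r X) X (pre p (φ (n + 1))) (s (n + 1)) ⊂
            gua d v (rel r X) X (pre p (φ n)) (s n)) →
      v p ∈ ⋂ n, gua d v (rel r X) X (pre p (φ n)) (s n))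
    (h3 : ∀ I : Set O, Extremal r I → ∀ γ : List C, (v ⁻¹' I ∩ ext γ) ∈ Γ)
    (h4 : ∀ (D : Set (List C)) (W : Set (ℕ → C)), W ∈ Γ → Determined D W) :
    ∃ σ : List C → C, ∀ (γ : List C) (X : Bool) (σ' : List C → C), Dev d X σ σ' →
      ¬ rel r X (v (play σ γ)) (v (play σ' γ)) := by
  choose s hs using fun X =>
    exists_forall_gua_subset_Gua (h1.rel X) (d := d) (v := v) (a := X) (h2 X)
  refine ⟨fun h => s (d h) h, fun γ X σ' hdev => ?_⟩
  refine not_rel_of_mem_Gua (d := d) h1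
    (fun D => h4 D _ (h3 _ (extremal_setOf_rel h1 X _) γ)) ?_ ?_
  · refine hs X γ (mem_gua (h1.rel X) (play_consistent γ fun x hx => ?_))
    rw [hx]
  · refine hs (!X) γ (mem_gua (h1.rel _) (play_consistent γ fun x hx => ?_))
    rw [hdev x (by simp [hx]), ← hx]
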